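/- Let (C, ς, A, ψ) be an entwining structure over a field k. Then the set of linear maps f : C → A that are both compatible with ψ and ψ-central is a unital subalgebra of the convolution algebra Hom_k(C, A): the convolution unit η∘ε is compatible with ψ and ψ-central, and if f and g are compatible with ψ and ψ-central then so is f*g. -/

import Mathlib

open TensorProduct LinearMap

noncomputable section

/-- An entwining structure `(C, ς, A, ψ)` over a field `k`: a braided coalgebra `(C, ς)`
together with an entwining map `ψ : C⊗A → A⊗C` compatible with the algebra structure of `A`,
the coalgebra structure of `C` and with the braid `ς`. -/
structure Entwining (k C A : Type*) [Field k] [AddCommGroup C] [Module k C] [Coalgebra k C]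
    [Ring A] [Algebra k A] where
  /-- the braid of `C` -/
  ς : C ⊗[k] C →ₗ[k] C ⊗[k] C
  /-- the entwining map -/
  ψ : C ⊗[k] A →ₗ[k] A ⊗[k] C
  ς_bij : Function.Bijective ς
  ψ_bij : Function.Bijective ψ
  /-- `(ς⊗C)∘(C⊗ς)∘(ς⊗C) = (C⊗ς)∘(ς⊗C)∘(C⊗ς)` -/
  braid_eq :
    rTensor C ς ∘ₗ (TensorProduct.assoc k C C C).symm.toLinearMap ∘ₗ lTensor C ς
        ∘ₗ (TensorProduct.assoc k C C C).toLinearMap ∘ₗ rTensor C ς =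
      (TensorProduct.assoc k C C C).symm.toLinearMap ∘ₗ lTensor C ς
        ∘ₗ (TensorProduct.assoc k C C C).toLinearMap ∘ₗ rTensor C ς
        ∘ₗ (TensorProduct.assoc k C C C).symm.toLinearMap ∘ₗ lTensor C ς
        ∘ₗ (TensorProduct.assoc k C C C).toLinearMap
  /-- `(C⊗ε)∘ς = ε⊗C` -/
  ς_counit_left :
    (TensorProduct.rid k C).toLinearMap ∘ₗ lTensor C (Coalgebra.counit (R := k)) ∘ₗ ς =
      (TensorProduct.lid k C).toLinearMap ∘ₗ rTensor C (Coalgebra.counit (R := k))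
  /-- `(ε⊗C)∘ς = C⊗ε` -/
  ς_counit_right :
    (TensorProduct.lid k C).toLinearMap ∘ₗ rTensor C (Coalgebra.counit (R := k)) ∘ₗ ς =
      (TensorProduct.rid k C).toLinearMap ∘ₗ lTensor C (Coalgebra.counit (R := k))
  /-- `(C⊗Δ)∘ς = (ς⊗C)∘(C⊗ς)∘(Δ⊗C)` -/
  ς_comul_left :
    lTensor C (Coalgebra.comul (R := k)) ∘ₗ ς =
      (TensorProduct.assoc k C C C).toLinearMap ∘ₗ rTensor C ς
        ∘ₗ (TensorProduct.assoc k C C C).symm.toLinearMap ∘ₗ lTensor C ς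
        ∘ₗ (TensorProduct.assoc k C C C).toLinearMap ∘ₗ rTensor C (Coalgebra.comul (R := k))
  /-- `(Δ⊗C)∘ς = (C⊗ς)∘(ς⊗C)∘(C⊗Δ)` -/
  ς_comul_right :
    rTensor C (Coalgebra.comul (R := k)) ∘ₗ ς =
      (TensorProduct.assoc k C C C).symm.toLinearMap ∘ₗ lTensor C ς
        ∘ₗ (TensorProduct.assoc k C C C).toLinearMap ∘ₗ rTensor C ς
        ∘ₗ (TensorProduct.assoc k C C C).symm.toLinearMap ∘ₗ lTensor C (Coalgebra.comul (R := k))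
  /-- `ψ(c⊗1) = 1⊗c` -/
  ψ_one : ∀ c : C, ψ (c ⊗ₜ[k] (1 : A)) = (1 : A) ⊗ₜ[k] c
  /-- `ψ∘(C⊗μ) = (μ⊗C)∘(A⊗ψ)∘(ψ⊗A)` -/
  ψ_mul :
    ψ ∘ₗ lTensor C (LinearMap.mul' k A) =
      rTensor C (LinearMap.mul' k A) ∘ₗ (TensorProduct.assoc k A A C).symm.toLinearMap
        ∘ₗ lTensor A ψ ∘ₗ (TensorProduct.assoc k A C A).toLinearMap
        ∘ₗ rTensor A ψ ∘ₗ (TensorProduct.assoc k C A A).symm.toLinearMap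
  /-- `(A⊗ε)∘ψ = ε⊗A` -/
  ψ_counit :
    (TensorProduct.rid k A).toLinearMap ∘ₗ lTensor A (Coalgebra.counit (R := k)) ∘ₗ ψ =
      (TensorProduct.lid k A).toLinearMap ∘ₗ rTensor A (Coalgebra.counit (R := k))
  /-- `(A⊗Δ)∘ψ = (ψ⊗C)∘(C⊗ψ)∘(Δ⊗A)` -/
  ψ_comul :
    lTensor A (Coalgebra.comul (R := k)) ∘ₗ ψ =
      (TensorProduct.assoc k A C C).toLinearMap ∘ₗ rTensor C ψ
        ∘ₗ (TensorProduct.assoc k C A C).symm.toLinearMap ∘ₗ lTensor C ψ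
        ∘ₗ (TensorProduct.assoc k C C A).toLinearMap ∘ₗ rTensor A (Coalgebra.comul (R := k))
  /-- `(A⊗ς)∘(ψ⊗C)∘(C⊗ψ) = (ψ⊗C)∘(C⊗ψ)∘(ς⊗A)` -/
  ψ_braid :
    lTensor A ς ∘ₗ (TensorProduct.assoc k A C C).toLinearMap ∘ₗ rTensor C ψ
        ∘ₗ (TensorProduct.assoc k C A C).symm.toLinearMap ∘ₗ lTensor C ψ =
      (TensorProduct.assoc k A C C).toLinearMap ∘ₗ rTensor C ψ
        ∘ₗ (TensorProduct.assoc k C A C).symm.toLinearMap ∘ₗ lTensor C ψ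
        ∘ₗ (TensorProduct.assoc k C C A).toLinearMap ∘ₗ rTensor A ς
        ∘ₗ (TensorProduct.assoc k C C A).symm.toLinearMap

variable {k C A : Type*} [Field k] [AddCommGroup C] [Module k C] [Coalgebra k C]
  [Ring A] [Algebra k A]

/-- `f : C → A` is compatible with `ψ` : `ψ∘(C⊗f) = (f⊗C)∘ς`. -/
def Entwining.Compat (E : Entwining k C A) (f : C →ₗ[k] A) : Prop :=
  E.ψ ∘ₗ lTensor C f = rTensor C f ∘ₗ E.ς

/-- `f : C → A` is `ψ`-central : `μ∘(A⊗f)∘ψ = μ∘(f⊗A)`. -/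
def Entwining.Central (E : Entwining k C A) (f : C →ₗ[k] A) : Prop :=
  LinearMap.mul' k A ∘ₗ lTensor A f ∘ₗ E.ψ = LinearMap.mul' k A ∘ₗ rTensor A f

/-- The convolution product `f*g = μ∘(f⊗g)∘Δ` on `Hom_k(C,A)`. -/
def convMul (f g : C →ₗ[k] A) : C →ₗ[k] A :=
  LinearMap.mul' k A ∘ₗ TensorProduct.map f g ∘ₗ Coalgebra.comul (R := k)

/-- The convolution unit `η∘ε`. -/
def convOne : C →ₗ[k] A :=
  Algebra.linearMap k A ∘ₗ Coalgebra.counit (R := k)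

/-- The braided coalgebra `(C, ς)` is cocommutative: `ς∘ς = id` and `ς∘Δ = Δ`. -/
def Entwining.Cocomm (E : Entwining k C A) : Prop :=
  E.ς ∘ₗ E.ς = LinearMap.id ∧ E.ς ∘ₗ Coalgebra.comul (R := k) = Coalgebra.comul (R := k)

namespace Entwining

variable {E : Entwining k C A} {f g : C →ₗ[k] A}

theorem Compat.apply (hf : E.Compat f) (c d : C) :
    E.ψ (c ⊗ₜ[k] f d) = rTensor C f (E.ς (c ⊗ₜ[k] d)) := by
  simpa using LinearMap.congr_fun hf (c ⊗ₜ[k] d)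

theorem Central.apply (hf : E.Central f) (c : C) (a : A) :
    LinearMap.mul' k A (lTensor A f (E.ψ (c ⊗ₜ[k] a))) = f c * a := by
  simpa using LinearMap.congr_fun hf (c ⊗ₜ[k] a)

theorem Compat.add (hf : E.Compat f) (hg : E.Compat g) : E.Compat (f + g) := by
  unfold Compat at *
  rw [lTensor_add, rTensor_add, comp_add, add_comp, hf, hg]

theorem Central.add (hf : E.Central f) (hg : E.Central g) : E.Central (f + g) := by
  unfold Central at *
  rw [lTensor_add, rTensor_add, add_comp, comp_add, comp_add, hf, hg]

theorem Compat.smul (a : k) (hf : E.Compat f) : E.Compat (a • f) := by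
  unfold Compat at *
  rw [lTensor_smul, rTensor_smul, comp_smul, smul_comp, hf]

theorem Central.smul (a : k) (hf : E.Central f) : E.Central (a • f) := by
  unfold Central at *
  rw [lTensor_smul, rTensor_smul, smul_comp, comp_smul, comp_smul, hf]

variable (E) in
theorem compat_convOne : E.Compat (convOne : C →ₗ[k] A) := by
  refine TensorProduct.ext' fun c d => ?_
  have key (s : C ⊗[k] C) : rTensor C (convOne : C →ₗ[k] A) s =
      (1 : A) ⊗ₜ[k] TensorProduct.lid k C (rTensor C (Coalgebra.counit (R := k)) s) := by
    induction s with
    | zero => simp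
    | add x y hx hy => simp only [map_add, hx, hy, tmul_add]
    | tmul x y => simp [_root_.convOne, Algebra.algebraMap_eq_smul_one, smul_tmul]
  have h := LinearMap.congr_fun E.ς_counit_right (c ⊗ₜ[k] d)
  simp only [coe_comp, LinearEquiv.coe_coe, Function.comp_apply, lTensor_tmul, rid_tmul] at h
  simp only [coe_comp, Function.comp_apply, lTensor_tmul]
  rw [key, h]
  simp [_root_.convOne, Algebra.algebraMap_eq_smul_one, E.ψ_one]

variable (E) in
theorem central_convOne : E.Central (convOne : C →ₗ[k] A) := by
  refine TensorProduct.ext' fun c a => ?_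
  have key (s : A ⊗[k] C) : LinearMap.mul' k A (lTensor A (convOne : C →ₗ[k] A) s) =
      TensorProduct.rid k A (lTensor A (Coalgebra.counit (R := k)) s) := by
    induction s with
    | zero => simp
    | add x y hx hy => simp only [map_add, hx, hy]
    | tmul x y => simp [_root_.convOne, Algebra.algebraMap_eq_smul_one]
  have h := LinearMap.congr_fun E.ψ_counit (c ⊗ₜ[k] a)
  simp only [coe_comp, LinearEquiv.coe_coe, Function.comp_apply, rTensor_tmul, lid_tmul] at h
  simp only [coe_comp, Function.comp_apply, rTensor_tmul]
  rw [key, h]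
  simp [_root_.convOne, Algebra.algebraMap_eq_smul_one]

/-- `ψ∘(C⊗μ(f⊗g)) = (μ(f⊗g)⊗C)∘(C⊗ς)∘(ς⊗C)` for compatible `f` and `g`. -/
theorem Compat.ψ_mul_map (hf : E.Compat f) (hg : E.Compat g) (c : C) (t : C ⊗[k] C) :
    E.ψ (c ⊗ₜ[k] LinearMap.mul' k A (TensorProduct.map f g t)) =
      rTensor C (LinearMap.mul' k A ∘ₗ TensorProduct.map f g)
        ((TensorProduct.assoc k C C C).symm (lTensor C E.ς (TensorProduct.assoc k C C C
          (rTensor C E.ς ((TensorProduct.assoc k C C C).symm (c ⊗ₜ[k] t)))))) := by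
  induction t with
  | zero => simp
  | add x y hx hy => simp only [map_add, tmul_add, hx, hy]
  | tmul d e =>
    have h := LinearMap.congr_fun E.ψ_mul (c ⊗ₜ[k] (f d ⊗ₜ[k] g e))
    simp only [coe_comp, LinearEquiv.coe_coe, Function.comp_apply, lTensor_tmul, assoc_symm_tmul,
      rTensor_tmul, hf.apply] at h
    rw [map_tmul, h, assoc_symm_tmul, rTensor_tmul]
    generalize E.ς (c ⊗ₜ[k] d) = s
    induction s with
    | zero => simp
    | add x y hx hy => simp only [map_add, add_tmul, hx, hy]
    | tmul p q =>
      simp only [rTensor_tmul, assoc_tmul, lTensor_tmul, hg.apply]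
      generalize E.ς (q ⊗ₜ[k] e) = u
      induction u with
      | zero => simp
      | add x y hx hy => simp only [map_add, tmul_add, hx, hy]
      | tmul x y => simp

theorem Compat.convMul (hf : E.Compat f) (hg : E.Compat g) : E.Compat (convMul f g) := by
  refine TensorProduct.ext' fun c d => ?_
  have h := LinearMap.congr_fun E.ς_comul_right (c ⊗ₜ[k] d)
  simp only [coe_comp, LinearEquiv.coe_coe, Function.comp_apply, lTensor_tmul] at h
  simp only [_root_.convMul, coe_comp, Function.comp_apply, lTensor_tmul, hf.ψ_mul_map hg, ← h,
    rTensor_comp]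

/-- `μ(A⊗μ(f⊗g))∘(ψ⊗C)∘(C⊗ψ) = μ(μ(f⊗g)⊗A)` for `ψ`-central `f` and `g`. -/
theorem Central.mul_map_ψ (hf : E.Central f) (hg : E.Central g) (t : C ⊗[k] C) (a : A) :
    LinearMap.mul' k A (lTensor A (LinearMap.mul' k A ∘ₗ TensorProduct.map f g)
      (TensorProduct.assoc k A C C (rTensor C E.ψ ((TensorProduct.assoc k C A C).symm
        (lTensor C E.ψ (TensorProduct.assoc k C C A (t ⊗ₜ[k] a))))))) =
      LinearMap.mul' k A (TensorProduct.map f g t) * a := by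
  induction t with
  | zero => simp
  | add x y hx hy => simp only [map_add, add_tmul, add_mul, hx, hy]
  | tmul c d =>
    rw [assoc_tmul, lTensor_tmul, map_tmul, mul'_apply, mul_assoc, ← hg.apply]
    generalize E.ψ (d ⊗ₜ[k] a) = s
    induction s with
    | zero => simp
    | add x y hx hy => simp only [map_add, tmul_add, mul_add, hx, hy]
    | tmul b e =>
      rw [assoc_symm_tmul, rTensor_tmul, lTensor_tmul, mul'_apply, ← mul_assoc, ← hf.apply]
      generalize E.ψ (c ⊗ₜ[k] b) = u
      induction u with
      | zero => simp
      | add x y hx hy => simp only [map_add, add_tmul, add_mul, hx, hy]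
      | tmul x y => simp [mul_assoc]

theorem Central.convMul (hf : E.Central f) (hg : E.Central g) : E.Central (convMul f g) := by
  refine TensorProduct.ext' fun c a => ?_
  have h := LinearMap.congr_fun E.ψ_comul (c ⊗ₜ[k] a)
  simp only [coe_comp, LinearEquiv.coe_coe, Function.comp_apply, rTensor_tmul] at h
  have key := hf.mul_map_ψ hg (Coalgebra.comul (R := k) c) a
  rw [← h] at key
  simpa [_root_.convMul, lTensor_comp] using key

end Entwining

/-- Proposition 1.18(2): the maps `C → A` compatible with `ψ` and `ψ`-central
form a unital subalgebra of the convolution algebra `Hom_k(C, A)`. -/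
theorem compat_central_subalgebra (E : Entwining k C A) :
    (∀ f g : C →ₗ[k] A, E.Compat f ∧ E.Central f → E.Compat g ∧ E.Central g →
        E.Compat (f + g) ∧ E.Central (f + g)) ∧
    (∀ (a : k) (f : C →ₗ[k] A), E.Compat f ∧ E.Central f →
        E.Compat (a • f) ∧ E.Central (a • f)) ∧
    (E.Compat (convOne : C →ₗ[k] A) ∧ E.Central (convOne : C →ₗ[k] A)) ∧
    (∀ f g : C →ₗ[k] A, E.Compat f ∧ E.Central f → E.Compat g ∧ E.Central g →
        E.Compat (convMul f g) ∧ E.Central (convMul f g)) := by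
  exact ⟨fun _ _ hf hg => ⟨hf.1.add hg.1, hf.2.add hg.2⟩,
    fun a _ hf => ⟨hf.1.smul a, hf.2.smul a⟩,
    ⟨E.compat_convOne, E.central_convOne⟩,
    fun _ _ hf hg => ⟨hf.1.convMul hg.1, hf.2.convMul hg.2⟩⟩
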